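/- arXiv:2309.05487 — 13 statements merged into one kernel-verified Lean document; each statement's English description precedes it below -/
import Mathlib

section
/- Let A and B be convex sets in ℝⁿ with rec A = rec B and B ⊆ A. If A is a polyhedral convex set with at least one vertex (extreme point), then the Hausdorff distance between A and B equals the maximum, over all vertices v of A, of the distance d(v,B) from v to B; that is, δ^H(A,B) = max_{v ∈ ver A} d(v,B). -/
open Metric Set

/-- The recession cone of a set `A`: all directions `k` such that `a + μ • k ∈ A`
for every `a ∈ A` and every `μ ≥ 0`. -/
def recCone {V : Type*} [AddCommGroup V] [Module ℝ V] (A : Set V) : Set V :=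
  {k | ∀ a ∈ A, ∀ μ : ℝ, 0 ≤ μ → a + μ • k ∈ A}

/-- A polyhedral convex set: a finite intersection of closed halfspaces. -/
def IsPolyhedralSet {V : Type*} [AddCommGroup V] [Module ℝ V] (A : Set V) : Prop :=
  ∃ (m : ℕ) (f : Fin m → (V →ₗ[ℝ] ℝ)) (a : Fin m → ℝ), A = ⋂ i, {x | a i ≤ f i x}

section Polyhedron

variable {V : Type*} [AddCommGroup V] [Module ℝ V]

/-- If the functionals active at a point `x` of a polyhedron vanish on `d`, then `x` can be moved
a positive amount along `d` within the polyhedron, and activates a new constraint on the way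
if some functional is negative on `d`. -/
theorem exists_pos_add_smul_mem_polyhedron {ι : Type*} [Fintype ι] (f : ι → (V →ₗ[ℝ] ℝ))
    (a : ι → ℝ) {x d : V} (hx : ∀ i, a i ≤ f i x) (hd : ∀ i, f i x = a i → f i d = 0) :
    ∃ t : ℝ, 0 < t ∧ (∀ i, a i ≤ f i (x + t • d)) ∧
      ((∃ j, f j d < 0) → ∃ j, f j x ≠ a j ∧ f j (x + t • d) = a j) := by
  classical
  by_cases h : ∃ j, f j d < 0
  · obtain ⟨j₀, hj₀⟩ := h
    obtain ⟨j, hj, hmin⟩ := Finset.exists_min_image (Finset.univ.filter fun j => f j d < 0)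
      (fun j => (f j x - a j) / (-f j d)) ⟨j₀, by simpa using hj₀⟩
    simp only [Finset.mem_filter, Finset.mem_univ, true_and] at hj hmin
    have hne : f j x ≠ a j := fun h => hj.ne (hd j h)
    refine ⟨(f j x - a j) / (-f j d), ?_, fun i => ?_, fun _ => ⟨j, hne, ?_⟩⟩
    · exact div_pos (sub_pos.2 (lt_of_le_of_ne (hx j) hne.symm)) (by linarith)
    · have ht : 0 ≤ (f j x - a j) / (-f j d) :=
        div_nonneg (sub_nonneg.2 (hx j)) (by linarith)
      simp only [map_add, map_smul, smul_eq_mul]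
      rcases lt_or_ge (f i d) 0 with hi | hi
      · have := hmin i hi
        rw [le_div_iff₀ (by linarith)] at this
        linarith
      · linarith [hx i, mul_nonneg ht hi]
    · have := hj.ne
      simp only [map_add, map_smul, smul_eq_mul]
      field_simp
      ring
  · refine ⟨1, one_pos, fun i => ?_, fun h' => absurd h' h⟩
    push Not at h
    simpa using add_le_add (hx i) (h i)

theorem mem_openSegment_add_smul_sub_smul (x d : V) {s t : ℝ} (hs : 0 < s) (ht : 0 < t) :
    x ∈ openSegment ℝ (x + s • d) (x - t • d) := by
  refine ⟨t / (s + t), s / (s + t), by positivity, by positivity, by field_simp; ring, ?_⟩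
  match_scalars <;> field_simp <;> ring

/-- At an extreme point of a polyhedron, the active functionals separate points. -/
theorem eq_zero_of_mem_extremePoints_polyhedron {ι : Type*} [Fintype ι] (f : ι → (V →ₗ[ℝ] ℝ))
    (a : ι → ℝ) {x d : V} (hx : x ∈ (⋂ i, {x | a i ≤ f i x}).extremePoints ℝ)
    (hd : ∀ i, f i x = a i → f i d = 0) : d = 0 := by
  have hxA : ∀ i, a i ≤ f i x := by simpa using hx.1
  obtain ⟨s, hs, hsA, -⟩ := exists_pos_add_smul_mem_polyhedron f a hxA hd
  obtain ⟨t, ht, htA, -⟩ := exists_pos_add_smul_mem_polyhedron f a (d := -d) hxA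
    (fun i hi => by simp [hd i hi])
  have h := hx.2 (x₁ := x + s • d) (by simpa using hsA) (x₂ := x - t • d)
    (by simpa [sub_eq_add_neg] using htA) (mem_openSegment_add_smul_sub_smul x d hs ht)
  simpa [hs.ne'] using h

theorem finite_extremePoints_polyhedron {ι : Type*} [Fintype ι] (f : ι → (V →ₗ[ℝ] ℝ))
    (a : ι → ℝ) : ((⋂ i, {x | a i ≤ f i x}).extremePoints ℝ).Finite := by
  refine Set.Finite.of_injOn (f := fun x => {i | f i x = a i}) (t := univ)
    (fun _ _ => mem_univ _) ?_ finite_univ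
  intro x hx y _ hxy
  have hiff : ∀ i, f i x = a i ↔ f i y = a i := fun i => Set.ext_iff.1 hxy i
  refine (sub_eq_zero.1 (eq_zero_of_mem_extremePoints_polyhedron f a hx (d := y - x) ?_)).symm
  intro i hi
  rw [map_sub, hi, (hiff i).1 hi, sub_self]

/-- A quasiconvex function that does not increase along recession directions is dominated on a
polyhedron with a vertex by its values at the vertices. -/
theorem exists_extremePoint_polyhedron_le {ι : Type*} [Fintype ι] (f : ι → (V →ₗ[ℝ] ℝ))
    (a : ι → ℝ) (hver : ((⋂ i, {x | a i ≤ f i x}).extremePoints ℝ).Nonempty) {g : V → ℝ}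
    (hconv : ∀ x y, ∀ z ∈ segment ℝ x y, g z ≤ max (g x) (g y))
    (hrec : ∀ k ∈ recCone (⋂ i, {x | a i ≤ f i x}), ∀ x, g (x + k) ≤ g x)
    {x : V} (hx : x ∈ ⋂ i, {x | a i ≤ f i x}) :
    ∃ v ∈ (⋂ i, {x | a i ≤ f i x}).extremePoints ℝ, g x ≤ g v := by
  classical
  induction hN : (Finset.univ.filter fun i => f i x ≠ a i).card using Nat.strong_induction_on
    generalizing x with
  | _ N ih =>
  have hxA : ∀ i, a i ≤ f i x := by simpa using hx
  by_cases hxe : x ∈ (⋂ i, {x | a i ≤ f i x}).extremePoints ℝ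
  · exact ⟨x, hxe, le_rfl⟩
  obtain ⟨d, hd0, hd⟩ : ∃ d : V, d ≠ 0 ∧ ∀ i, f i x = a i → f i d = 0 := by
    rw [mem_extremePoints_iff_left] at hxe
    push Not at hxe
    obtain ⟨y, hy, z, hz, ⟨p, q, hp, hq, hpq, rfl⟩, hne⟩ := hxe hx
    refine ⟨y - z, fun h => hne ?_, fun i hi => ?_⟩
    · rw [← sub_eq_zero.1 h, ← add_smul, hpq, one_smul]
    · have hyi : a i ≤ f i y := by simpa using mem_iInter.1 hy i
      have hzi : a i ≤ f i z := by simpa using mem_iInter.1 hz i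
      simp only [map_add, map_smul, smul_eq_mul, map_sub] at hi ⊢
      have h1 : p * (f i y - a i) + q * (f i z - a i) = 0 := by
        linear_combination hi - a i * hpq
      have h2 := mul_nonneg hp.le (sub_nonneg.2 hyi)
      have h3 := mul_nonneg hq.le (sub_nonneg.2 hzi)
      have h4 := (mul_eq_zero.1 (by linarith : p * (f i y - a i) = 0)).resolve_left hp.ne'
      have h5 := (mul_eq_zero.1 (by linarith : q * (f i z - a i) = 0)).resolve_left hq.ne'
      linarith
  have step : ∀ e : V, (∀ i, f i x = a i → f i e = 0) → (∃ j, f j e < 0) →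
      ∃ t : ℝ, 0 < t ∧ ∃ v ∈ (⋂ i, {x | a i ≤ f i x}).extremePoints ℝ,
        g (x + t • e) ≤ g v := by
    intro e he hneg
    obtain ⟨t, ht, htA, hj⟩ := exists_pos_add_smul_mem_polyhedron f a hxA he
    obtain ⟨j, hjx, hjt⟩ := hj hneg
    refine ⟨t, ht, ih _ ?_ (by simpa using htA) rfl⟩
    rw [← hN]
    refine Finset.card_lt_card ((Finset.ssubset_iff_of_subset ?_).2
      ⟨j, by simpa using hjx, by simpa using hjt⟩)
    intro i
    simp only [Finset.mem_filter, Finset.mem_univ, true_and]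
    intro hi h
    exact hi (by simp [h, he i h])
  have mem_rec : ∀ e : V, (∀ i, 0 ≤ f i e) → ∀ t : ℝ, 0 < t →
      t • e ∈ recCone (⋂ i, {x | a i ≤ f i x}) := by
    intro e he t ht y hy μ hμ
    simp only [mem_iInter, mem_ofPred_eq, map_add, map_smul, smul_eq_mul] at hy ⊢
    intro i
    linarith [hy i, mul_nonneg hμ (mul_nonneg ht.le (he i))]
  have ray : ∀ e : V, (∀ i, f i x = a i → f i e = 0) → (∃ j, f j e < 0) → (∀ i, 0 ≤ f i (-e)) →
      ∃ v ∈ (⋂ i, {x | a i ≤ f i x}).extremePoints ℝ, g x ≤ g v := by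
    intro e he hneg hpos
    obtain ⟨t, ht, v, hv, hle⟩ := step e he hneg
    refine ⟨v, hv, le_trans ?_ hle⟩
    simpa using hrec _ (mem_rec (-e) hpos t ht) (x + t • e)
  have hd' : ∀ i, f i x = a i → f i (-d) = 0 := fun i hi => by simp [hd i hi]
  by_cases h1 : ∃ j, f j d < 0 <;> by_cases h2 : ∃ j, f j (-d) < 0
  · obtain ⟨s, hs, v, hv, hsv⟩ := step d hd h1
    obtain ⟨t, ht, w, hw, htw⟩ := step (-d) hd' h2
    have hmax := hconv _ _ x
      (openSegment_subset_segment ℝ _ _ (mem_openSegment_add_smul_sub_smul x d hs ht))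
    rw [smul_neg, ← sub_eq_add_neg] at htw
    rcases le_max_iff.1 hmax with h | h
    · exact ⟨v, hv, h.trans hsv⟩
    · exact ⟨w, hw, h.trans htw⟩
  · push Not at h2
    exact ray d hd h1 h2
  · push Not at h1
    exact ray (-d) hd' h2 (by simpa using h1)
  · push Not at h1 h2
    obtain ⟨v, hv⟩ := hver
    refine absurd (eq_zero_of_mem_extremePoints_polyhedron f a hv (d := d) fun i _ => ?_) hd0
    exact le_antisymm (by simpa using h2 i) (h1 i)

theorem eq_singleton_of_recCone_eq_univ {A : Set V} {v : V} (hrec : recCone A = univ)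
    (hv : v ∈ A.extremePoints ℝ) : A = {v} := by
  refine Subset.antisymm (fun x _ => ?_) (singleton_subset_iff.2 hv.1)
  have hmem : ∀ w, v + w ∈ A := fun w => by
    simpa using (hrec ▸ mem_univ w : w ∈ recCone A) v hv.1 1 zero_le_one
  have h := hv.2 (hmem _) (x₂ := v - (1 : ℝ) • (x - v)) (sub_eq_add_neg v _ ▸ hmem _)
    (mem_openSegment_add_smul_sub_smul v (x - v) one_pos one_pos)
  simpa using h

end Polyhedron

theorem infDist_le_max_of_mem_segment {E : Type*} [SeminormedAddCommGroup E] [NormedSpace ℝ E]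
    {B : Set E} (hB : Convex ℝ B) (hne : B.Nonempty) {x y z : E} (hz : z ∈ segment ℝ x y) :
    infDist z B ≤ max (infDist x B) (infDist y B) := by
  have hiff : ∀ w (r : ℝ), 0 ≤ r → (w ∈ cthickening r B ↔ infDist w B ≤ r) := fun w r hr => by
    rw [mem_cthickening_iff, infDist, ENNReal.le_ofReal_iff_toReal_le (infEDist_ne_top hne) hr]
  have hr : 0 ≤ max (infDist x B) (infDist y B) := infDist_nonneg.trans (le_max_left _ _)
  exact (hiff z _ hr).1 ((hB.cthickening _).segment_subset ((hiff x _ hr).2 (le_max_left _ _))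
    ((hiff y _ hr).2 (le_max_right _ _)) hz)

theorem infDist_add_le_of_mem_recCone {E : Type*} [SeminormedAddCommGroup E] [NormedSpace ℝ E]
    {B : Set E} (hne : B.Nonempty) {k : E} (hk : k ∈ recCone B) (x : E) :
    infDist (x + k) B ≤ infDist x B := by
  refine (le_infDist hne).2 fun b hb => ?_
  simpa using infDist_le_dist_of_mem (x := x + k)
    (by simpa using hk b hb 1 zero_le_one : b + k ∈ B)

/-- If `A, B ⊆ ℝⁿ` are convex, `rec A = rec B`, `B ⊆ A`, and `A` is
polyhedral with at least one vertex (extreme point), then the Hausdorff distance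
`δ^H(A,B)` equals the maximum over vertices `v` of `A` of `d(v,B)`. -/
theorem hausdorffDist_eq_max_infDist_of_vertices {n : ℕ}
    (A B : Set (EuclideanSpace ℝ (Fin n)))
    (hA : Convex ℝ A) (hB : Convex ℝ B)
    (hrec : recCone A = recCone B) (hBA : B ⊆ A)
    (hpoly : IsPolyhedralSet A) (hver : (A.extremePoints ℝ).Nonempty) :
    IsGreatest ((fun v => Metric.infDist v B) '' (A.extremePoints ℝ))
      (Metric.hausdorffDist A B) := by
  rcases B.eq_empty_or_nonempty with rfl | hne
  · obtain ⟨v, hv⟩ := hver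
    obtain rfl := eq_singleton_of_recCone_eq_univ (hrec.trans (by simp [recCone])) hv
    simp
  obtain ⟨m, f, a, rfl⟩ := hpoly
  obtain ⟨v, hv, hmax⟩ := Set.exists_max_image _ (fun v => infDist v B)
    (finite_extremePoints_polyhedron f a) hver
  have hle : ∀ x ∈ ⋂ i, {x | a i ≤ f i x}, infDist x B ≤ infDist v B := fun x hx => by
    obtain ⟨w, hw, hxw⟩ := exists_extremePoint_polyhedron_le f a hver
      (g := fun x => infDist x B) (fun _ _ _ hz => infDist_le_max_of_mem_segment hB hne hz)
      (fun k hk => infDist_add_le_of_mem_recCone hne (hrec ▸ hk)) hx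
    exact hxw.trans (hmax w hw)
  have hfin : hausdorffEDist (⋂ i, {x | a i ≤ f i x}) B ≠ ⊤ := by
    refine ne_top_of_le_ne_top (ENNReal.ofReal_ne_top (r := infDist v B))
      (hausdorffEDist_le_of_infEDist (fun x hx => ?_) fun x hx => ?_)
    · exact (ENNReal.le_ofReal_iff_toReal_le (infEDist_ne_top hne) infDist_nonneg).2 (hle x hx)
    · simp [infEDist_zero_of_mem (hBA hx)]
  have heq : hausdorffDist (⋂ i, {x | a i ≤ f i x}) B = infDist v B :=
    le_antisymm (hausdorffDist_le_of_infDist infDist_nonneg hle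
      fun x hx => (infDist_zero_of_mem (hBA hx)).trans_le infDist_nonneg)
      (infDist_le_hausdorffDist_of_mem hv.1 hfin)
  rw [heq]
  exact ⟨mem_image_of_mem _ hv, forall_mem_image.2 hmax⟩
end

section
/- Let ε > 0, let X ⊆ ℝⁿ be a nonempty convex compact set, let g, h : ℝⁿ → ℝ be convex functions, and let ḡ : ℝⁿ → ℝ be an ε-polyhedral underestimator of g on X. Let x^g ∈ X be a minimizer of ḡ − h over X, let z* := min_{x∈X}(g(x) − h(x)) and z^g := min_{x∈X}(ḡ(x) − h(x)). Then x^g is an ε-solution of min_{x∈X}(g(x) − h(x)), and 0 ≤ z* − z^g ≤ ε. -/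
open Set

/-- A polyhedral convex function: one whose epigraph is a polyhedral convex set. -/
def IsPolyhedralFun {n : ℕ} (f : EuclideanSpace ℝ (Fin n) → ℝ) : Prop :=
  IsPolyhedralSet {p : EuclideanSpace ℝ (Fin n) × ℝ | f p.1 ≤ p.2}

/-- If `ḡ` is an `ε`-polyhedral underestimator of `g` on `X` and `x^g`
minimizes `ḡ - h` over `X`, then `x^g` is an `ε`-solution of `min_{x∈X}(g(x) - h(x))`
and `0 ≤ z* - z^g ≤ ε`, where `z*`, `z^g` are the optimal values of the two problems. -/
theorem eps_solution_of_polyhedral_underestimator_g {n : ℕ}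
    (ε : ℝ) (hε : 0 < ε)
    (X : Set (EuclideanSpace ℝ (Fin n)))
    (hXne : X.Nonempty) (hXconv : Convex ℝ X) (hXcomp : IsCompact X)
    (g h gbar : EuclideanSpace ℝ (Fin n) → ℝ)
    (hg : ConvexOn ℝ Set.univ g) (hh : ConvexOn ℝ Set.univ h)
    (hpoly : IsPolyhedralFun gbar)
    (hunder : ∀ x ∈ X, 0 ≤ g x - gbar x ∧ g x - gbar x ≤ ε)
    (xg : EuclideanSpace ℝ (Fin n)) (hxg : xg ∈ X)
    (hxgmin : ∀ x ∈ X, gbar xg - h xg ≤ gbar x - h x)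
    (zstar zg : ℝ)
    (hzstar : IsLeast ((fun x => g x - h x) '' X) zstar)
    (hzg : IsLeast ((fun x => gbar x - h x) '' X) zg) :
    g xg - h xg ≤ zstar + ε ∧ 0 ≤ zstar - zg ∧ zstar - zg ≤ ε := by
  obtain ⟨⟨x, hx, rfl⟩, hstar_le⟩ := hzstar
  obtain ⟨⟨y, hy, rfl⟩, hg_le⟩ := hzg
  have hstar_xg := hstar_le (mem_image_of_mem _ hxg)
  have hg_x := hg_le (mem_image_of_mem _ hx)
  have hxg_x := hxgmin x hx
  have hxg_y := hxgmin y hy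
  have hux := hunder x hx
  have huxg := hunder xg hxg
  dsimp only at *
  refine ⟨?_, ?_, ?_⟩ <;> linarith
end

section
/- Let ε > 0, let X ⊆ ℝⁿ be a nonempty convex compact set, let g, h : ℝⁿ → ℝ be convex functions, and let h̄ : ℝⁿ → ℝ be an ε-polyhedral underestimator of h on X. Let x^h ∈ X be a minimizer of g − h̄ over X, let z* := min_{x∈X}(g(x) − h(x)) and z^h := min_{x∈X}(g(x) − h̄(x)). Then x^h is an ε-solution of min_{x∈X}(g(x) − h(x)), and 0 ≤ z^h − z* ≤ ε. -/
open Set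

/-- If `h̄` is an `ε`-polyhedral underestimator of `h` on `X` and `x^h`
minimizes `g - h̄` over `X`, then `x^h` is an `ε`-solution of `min_{x∈X}(g(x) - h(x))`
and `0 ≤ z^h - z* ≤ ε`, where `z*`, `z^h` are the optimal values of the two problems. -/
theorem eps_solution_of_polyhedral_underestimator_h {n : ℕ}
    (ε : ℝ) (hε : 0 < ε)
    (X : Set (EuclideanSpace ℝ (Fin n)))
    (hXne : X.Nonempty) (hXconv : Convex ℝ X) (hXcomp : IsCompact X)
    (g h hbar : EuclideanSpace ℝ (Fin n) → ℝ)
    (hg : ConvexOn ℝ Set.univ g) (hh : ConvexOn ℝ Set.univ h)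
    (hpoly : IsPolyhedralFun hbar)
    (hunder : ∀ x ∈ X, 0 ≤ h x - hbar x ∧ h x - hbar x ≤ ε)
    (xh : EuclideanSpace ℝ (Fin n)) (hxh : xh ∈ X)
    (hxhmin : ∀ x ∈ X, g xh - hbar xh ≤ g x - hbar x)
    (zstar zh : ℝ)
    (hzstar : IsLeast ((fun x => g x - h x) '' X) zstar)
    (hzh : IsLeast ((fun x => g x - hbar x) '' X) zh) :
    g xh - h xh ≤ zstar + ε ∧ 0 ≤ zh - zstar ∧ zh - zstar ≤ ε := by
  obtain ⟨⟨y, hy, rfl⟩, hlow⟩ := hzstar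
  obtain ⟨⟨w, hw, rfl⟩, hlow'⟩ := hzh
  have hxhy := hxhmin y hy
  have hle := hlow (mem_image_of_mem _ hw)
  have hle' := hlow' (mem_image_of_mem _ hy)
  have hux := hunder xh hxh
  have huy := hunder y hy
  have huw := hunder w hw
  dsimp only at hle hle' ⊢
  refine ⟨?_, ?_, ?_⟩ <;> linarith
end

section
/- Let ε > 0, let X = [ℓ,u] ⊆ ℝⁿ be a compact box with nonempty interior, let g : ℝⁿ → ℝ be convex, and let ḡ : ℝⁿ → ℝ be the pointwise maximum of finitely many affine functions with ḡ(x) ≤ g(x) for all x ∈ X. Let C := epi ḡ ∩ (X × ℝ), a polyhedral convex set with nonempty vertex set. If g(x) − y ≤ ε for every vertex (x,y) of C, then ḡ is an ε-polyhedral underestimator of g on X, i.e., 0 ≤ g(x) − ḡ(x) ≤ ε for all x ∈ X. -/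
open Set
open scoped RealInnerProductSpace

/-- The points of `A` where a convex function attains an upper bound form an extreme set of `A`. -/
theorem ConvexOn.isExtreme_setOf_eq {E : Type*} [AddCommGroup E] [Module ℝ E] {s A : Set E}
    {f : E → ℝ} {M : ℝ} (hf : ConvexOn ℝ s f) (hA : A ⊆ s) (hM : ∀ x ∈ A, f x ≤ M) :
    IsExtreme ℝ A {x ∈ A | f x = M} := by
  refine ⟨fun x hx ↦ hx.1, ?_⟩
  rintro x hx y hy _ ⟨-, hz⟩ ⟨a, b, ha, hb, hab, rfl⟩
  refine ⟨hx, (hM x hx).antisymm ?_⟩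
  have hle := hf.2 (hA hx) (hA hy) ha.le hb.le hab
  rw [hz, smul_eq_mul, smul_eq_mul] at hle
  have hby := mul_le_mul_of_nonneg_left (hM y hy) hb.le
  refine le_of_mul_le_mul_left ?_ ha
  linear_combination hle + hby + M * hab

/-- A coordinate box in Euclidean space is compact. -/
theorem EuclideanSpace.isCompact_box {ι : Type*} [Fintype ι] (l u : EuclideanSpace ℝ ι) :
    IsCompact {x : EuclideanSpace ℝ ι | ∀ i, l i ≤ x i ∧ x i ≤ u i} := by
  have h := (PiLp.homeomorph 2 (fun _ : ι ↦ ℝ)).isCompact_preimage.2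
    (isCompact_univ_pi fun i ↦ isCompact_Icc (a := l i) (b := u i))
  convert h using 1
  ext x
  simp [PiLp.homeomorph, Pi.le_def, forall_and]

/-- The maximum over a compact set `X` of `g - h`, with `g` convex, is attained at the base point
of an extreme point of the part of the epigraph of `h` that lies above `X`. -/
theorem ConvexOn.exists_mem_extremePoints_epigraph {E : Type*} [NormedAddCommGroup E]
    [NormedSpace ℝ E] {X : Set E} {g h : E → ℝ} (hX : IsCompact X) (hX₀ : X.Nonempty)
    (hg : ConvexOn ℝ univ g) (hgc : Continuous g) (hhc : Continuous h) :
    ∃ p ∈ {p : E × ℝ | h p.1 ≤ p.2 ∧ p.1 ∈ X}.extremePoints ℝ,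
      ∀ x ∈ X, g x - h x ≤ g p.1 - p.2 := by
  obtain ⟨x₀, hx₀, hmax⟩ := hX.exists_isMaxOn hX₀ (hgc.sub hhc).continuousOn
  simp only [isMaxOn_iff, Pi.sub_apply] at hmax
  set A := {p : E × ℝ | h p.1 ≤ p.2 ∧ p.1 ∈ X}
  have hf : ConvexOn ℝ univ fun p : E × ℝ ↦ g p.1 - p.2 :=
    (hg.comp_linearMap (LinearMap.fst ℝ E ℝ)).sub
      ((LinearMap.snd ℝ E ℝ).concaveOn convex_univ)
  have hM : ∀ p ∈ A, g p.1 - p.2 ≤ g x₀ - h x₀ := fun p hp ↦ by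
    linarith [hmax p.1 hp.2, hp.1]
  have hext := hf.isExtreme_setOf_eq (subset_univ A) hM
  have himage : {p ∈ A | g p.1 - p.2 = g x₀ - h x₀} =
      (fun x ↦ (x, h x)) '' (X ∩ {x | g x - h x = g x₀ - h x₀}) := by
    ext ⟨x, y⟩
    constructor
    · rintro ⟨⟨hy, hx⟩, he⟩
      have hxy : h x = y := by
        have := hmax x hx
        dsimp only at *
        linarith
      exact ⟨x, ⟨hx, by simpa [hxy] using he⟩, by simp [hxy]⟩
    · rintro ⟨x, ⟨hx, he⟩, ⟨⟩⟩
      exact ⟨⟨le_rfl, hx⟩, he⟩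
  have hcomp : IsCompact {p ∈ A | g p.1 - p.2 = g x₀ - h x₀} := by
    rw [himage]
    exact (hX.inter_right (isClosed_eq (hgc.sub hhc) continuous_const)).image (by fun_prop)
  obtain ⟨p, hp⟩ := hcomp.extremePoints_nonempty ⟨(x₀, h x₀), ⟨le_rfl, hx₀⟩, rfl⟩
  exact ⟨p, hext.extremePoints_subset_extremePoints hp,
    fun x hx ↦ (hmax x hx).trans_eq hp.1.2.symm⟩

/-- Let `X = [ℓ,u]` be a compact box with nonempty interior, `g` convex,
`ḡ` the pointwise maximum of finitely many affine functions with `ḡ ≤ g` on `X`, and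
`C := epi ḡ ∩ (X × ℝ)` (a polyhedral convex set with nonempty vertex set). If
`g(x) - y ≤ ε` for every vertex `(x,y)` of `C`, then `ḡ` is an `ε`-polyhedral
underestimator of `g` on `X`, i.e. `0 ≤ g(x) - ḡ(x) ≤ ε` for all `x ∈ X`. -/
theorem eps_underestimator_of_vertex_condition {n : ℕ}
    (ε : ℝ) (hε : 0 < ε)
    (ℓ u : EuclideanSpace ℝ (Fin n)) (hlu : ∀ i, ℓ i < u i)
    (X : Set (EuclideanSpace ℝ (Fin n)))
    (hX : X = {x | ∀ i, ℓ i ≤ x i ∧ x i ≤ u i})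
    (g gbar : EuclideanSpace ℝ (Fin n) → ℝ) (hg : ConvexOn ℝ Set.univ g)
    (m : ℕ) (c : Fin (m + 1) → EuclideanSpace ℝ (Fin n)) (b : Fin (m + 1) → ℝ)
    (hgbar : ∀ x, gbar x = ⨆ i, (⟪c i, x⟫ + b i))
    (hunder : ∀ x ∈ X, gbar x ≤ g x)
    (C : Set (EuclideanSpace ℝ (Fin n) × ℝ))
    (hC : C = {p | gbar p.1 ≤ p.2 ∧ p.1 ∈ X})
    (hver : (C.extremePoints ℝ).Nonempty)
    (hvertex : ∀ p ∈ C.extremePoints ℝ, g p.1 - p.2 ≤ ε) :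
    ∀ x ∈ X, 0 ≤ g x - gbar x ∧ g x - gbar x ≤ ε := by
  have hgc : Continuous g := hg.locallyLipschitz.continuous
  have hgbarc : Continuous gbar := by
    have hsup : gbar = fun x ↦ Finset.univ.sup' Finset.univ_nonempty fun i ↦ ⟪c i, x⟫ + b i := by
      ext x
      rw [hgbar, Finset.sup'_univ_eq_ciSup]
    rw [hsup]
    exact Continuous.finset_sup'_apply _ fun i _ ↦ by fun_prop
  have hXc : IsCompact X := hX ▸ EuclideanSpace.isCompact_box ℓ u
  intro x hx
  obtain ⟨p, hp, hmax⟩ := hg.exists_mem_extremePoints_epigraph hXc ⟨x, hx⟩ hgc hgbarc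
  exact ⟨sub_nonneg.2 (hunder x hx), (hmax x hx).trans (hvertex p (hC ▸ hp))⟩
end

section
/- Let g : ℝⁿ → ℝ be convex (hence continuous), let X ⊆ ℝⁿ be a nonempty convex compact set, let b := sup_{x∈X} g(x) (a finite real number), and let S := {(x,t) ∈ ℝⁿ × ℝ : t ≤ b}. Then the set A := epi g ∩ (X × ℝ) ∩ S is a nonempty convex compact set, and A + K = epi g ∩ (X × ℝ), where K := {(0,k) ∈ ℝⁿ × ℝ : k ≥ 0}. -/
open Set
open scoped Pointwise

/-- For convex `g : ℝⁿ → ℝ`, nonempty convex compact `X ⊆ ℝⁿ`,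
`b := sup_{x∈X} g(x)` and `S := {(x,t) : t ≤ b}`, the set
`A := epi g ∩ (X × ℝ) ∩ S` is a nonempty convex compact set and
`A + K = epi g ∩ (X × ℝ)` where `K = {(0,k) : k ≥ 0}`. -/
theorem truncated_epigraph_compact_and_recovers_epigraph {n : ℕ}
    (g : EuclideanSpace ℝ (Fin n) → ℝ) (hg : ConvexOn ℝ Set.univ g)
    (X : Set (EuclideanSpace ℝ (Fin n)))
    (hXne : X.Nonempty) (hXconv : Convex ℝ X) (hXcomp : IsCompact X)
    (b : ℝ) (hb : IsLUB (g '' X) b)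
    (A K : Set (EuclideanSpace ℝ (Fin n) × ℝ))
    (hA : A = {p | g p.1 ≤ p.2 ∧ p.1 ∈ X ∧ p.2 ≤ b})
    (hK : K = {p | p.1 = 0 ∧ 0 ≤ p.2}) :
    A.Nonempty ∧ Convex ℝ A ∧ IsCompact A ∧
      A + K = {p : EuclideanSpace ℝ (Fin n) × ℝ | g p.1 ≤ p.2 ∧ p.1 ∈ X} := by
  subst hA hK
  have hcont : Continuous g := hg.locallyLipschitz.continuous
  have hle : ∀ x ∈ X, g x ≤ b := fun x hx => hb.1 (mem_image_of_mem g hx)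
  refine ⟨?_, ?_, ?_, ?_⟩
  · obtain ⟨x, hx⟩ := hXne
    exact ⟨(x, g x), le_rfl, hx, hle x hx⟩
  · have hepi : Convex ℝ {p : EuclideanSpace ℝ (Fin n) × ℝ | g p.1 ≤ p.2} := by
      simpa using hg.convex_epigraph
    exact hepi.inter ((hXconv.linear_preimage (LinearMap.fst ℝ _ ℝ)).inter
      ((convex_Iic b).linear_preimage (LinearMap.snd ℝ (EuclideanSpace ℝ (Fin n)) ℝ)))
  · obtain ⟨m, hm⟩ := hXcomp.bddBelow_image hcont.continuousOn
    refine (hXcomp.prod (isCompact_Icc (a := m) (b := b))).of_isClosed_subset ?_ ?_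
    · exact (isClosed_le (hcont.comp continuous_fst) continuous_snd).inter
        ((hXcomp.isClosed.preimage continuous_fst).inter
          (isClosed_le continuous_snd continuous_const))
    · rintro p ⟨hp, hpX, hpb⟩
      exact ⟨hpX, (hm (mem_image_of_mem g hpX)).trans hp, hpb⟩
  · ext p
    constructor
    · rintro ⟨q, ⟨hq, hqX, -⟩, k, ⟨hk, hk'⟩, rfl⟩
      simp only [mem_ofPred_eq, Prod.fst_add, Prod.snd_add, hk, add_zero]
      exact ⟨by linarith, hqX⟩
    · rintro ⟨hp, hpX⟩
      refine ⟨(p.1, g p.1), ⟨le_rfl, hpX, hle _ hpX⟩, (0, p.2 - g p.1),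
        ⟨rfl, sub_nonneg.mpr hp⟩, ?_⟩
      ext <;> simp
end

section
/- Let g : ℝⁿ → ℝ be convex, let X = [ℓ,u] ⊆ ℝⁿ be a compact box with nonempty interior, let ḡ : ℝⁿ → ℝ be the pointwise maximum of finitely many affine functions with ḡ ≤ g on X, let b ≥ sup_{x∈X} g(x), and set S := {(x,t) : t ≤ b}, A := epi g ∩ (X × ℝ) ∩ S and Ā := epi ḡ ∩ (X × ℝ) ∩ S (a compact polyhedral convex set with nonempty vertex set). If (x̄, ȳ) attains max_{(x,y) ∈ ver Ā}(g(x) − y), then the Hausdorff distance (with respect to the Euclidean norm) satisfies δ^H(Ā, A) ≤ g(x̄) − ȳ. -/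
open Set
open scoped RealInnerProductSpace

/-- `ℝⁿ × ℝ` equipped with the Euclidean (ℓ²) norm, i.e. `ℝ^{n+1}`. -/
abbrev EucProd (n : ℕ) := WithLp 2 ((EuclideanSpace ℝ (Fin n)) × ℝ)

/-- Convert a point of `ℝ^{n+1}` to a pair `(x,t) ∈ ℝⁿ × ℝ`. -/
noncomputable def toProd {n : ℕ} (p : EucProd n) : (EuclideanSpace ℝ (Fin n)) × ℝ :=
  WithLp.equiv 2 _ p

/-- Build a point of `ℝ^{n+1}` from a pair `(x,t) ∈ ℝⁿ × ℝ`. -/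
noncomputable def ofProd {n : ℕ} (p : (EuclideanSpace ℝ (Fin n)) × ℝ) : EucProd n :=
  (WithLp.equiv 2 _).symm p

/-- A set cut out of `X × ℝ` by finitely many affine minorants and a level bound is compact when
`X` is. -/
theorem isCompact_truncated_epi {n m : ℕ} {X : Set (EuclideanSpace ℝ (Fin n))}
    (hX : IsCompact X) (c : Fin (m + 1) → EuclideanSpace ℝ (Fin n)) (d : Fin (m + 1) → ℝ)
    (b : ℝ) :
    IsCompact {p : EucProd n | (∀ i, ⟪c i, p.fst⟫ + d i ≤ p.snd) ∧ p.fst ∈ X ∧ p.snd ≤ b} := by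
  obtain ⟨r, hr⟩ := hX.bddBelow_image
    (f := fun x => ⟪c 0, x⟫ + d 0) (by fun_prop)
  have hK : IsCompact (WithLp.prodContinuousLinearEquiv 2 ℝ (EuclideanSpace ℝ (Fin n)) ℝ ⁻¹'
      (X ×ˢ Icc r b)) :=
    (WithLp.prodContinuousLinearEquiv 2 ℝ (EuclideanSpace ℝ (Fin n)) ℝ).toHomeomorph
      |>.isCompact_preimage.2 (hX.prod isCompact_Icc)
  refine hK.of_isClosed_subset ?_ ?_
  · refine IsClosed.inter (s₁ := {p : EucProd n | ∀ i, ⟪c i, p.fst⟫ + d i ≤ p.snd}) ?_ ?_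
    · simp only [ofPred_forall]
      exact isClosed_iInter fun i => isClosed_le (by fun_prop) (by fun_prop)
    · exact (hX.isClosed.preimage (f := fun p : EucProd n => p.fst) (by fun_prop)).inter
        (isClosed_le (f := fun p : EucProd n => p.snd) (by fun_prop) continuous_const)
  · rintro p ⟨h, hx, hb⟩
    exact ⟨hx, (hr ⟨p.fst, hx, rfl⟩).trans (h 0), hb⟩

/-- A set cut out of `X × ℝ` by finitely many affine minorants and a level bound is convex when
`X` is. -/
theorem convex_truncated_epi {n m : ℕ} {X : Set (EuclideanSpace ℝ (Fin n))}
    (hX : Convex ℝ X) (c : Fin (m + 1) → EuclideanSpace ℝ (Fin n)) (d : Fin (m + 1) → ℝ)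
    (b : ℝ) :
    Convex ℝ {p : EucProd n | (∀ i, ⟪c i, p.fst⟫ + d i ≤ p.snd) ∧ p.fst ∈ X ∧ p.snd ≤ b} := by
  rintro p ⟨hp, hpX, hpb⟩ q ⟨hq, hqX, hqb⟩ α β hα hβ hαβ
  refine ⟨fun i => ?_, hX hpX hqX hα hβ hαβ, ?_⟩
  · have h1 := mul_le_mul_of_nonneg_left (hp i) hα
    have h2 := mul_le_mul_of_nonneg_left (hq i) hβ
    have h3 : d i = α * d i + β * d i := by rw [← add_mul, hαβ, one_mul]
    simp only [WithLp.add_fst, WithLp.smul_fst, WithLp.add_snd, WithLp.smul_snd, inner_add_right,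
      inner_smul_right, smul_eq_mul]
    linarith
  · exact convex_Iic b hpb hqb hα hβ hαβ

/-- On a compact convex set, a bound on a continuous convex function at the extreme points holds
everywhere. -/
theorem ConvexOn.le_of_forall_extremePoints_le {E : Type*} [NormedAddCommGroup E]
    [NormedSpace ℝ E] {f : E → ℝ} (hf : ConvexOn ℝ univ f) (hcont : Continuous f) {K : Set E}
    (hK : IsCompact K) (hKc : Convex ℝ K) {r : ℝ} (h : ∀ p ∈ K.extremePoints ℝ, f p ≤ r) :
    ∀ p ∈ K, f p ≤ r := by
  have hconv : Convex ℝ {p | f p ≤ r} := by simpa using hf.convex_le r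
  change K ⊆ {p | f p ≤ r}
  rw [← closure_convexHull_extremePoints hK hKc]
  exact closure_minimal (convexHull_min h hconv) (isClosed_le hcont continuous_const)

/-- With `X = [ℓ,u]` a compact box with nonempty interior, `g` convex,
`ḡ` a pointwise maximum of finitely many affine functions with `ḡ ≤ g` on `X`,
`b ≥ sup_{x∈X} g`, `A := epi g ∩ (X × ℝ) ∩ S` and `Ā := epi ḡ ∩ (X × ℝ) ∩ S` where
`S = {(x,t) : t ≤ b}`: if `(x̄,ȳ)` attains `max_{(x,y) ∈ ver Ā} (g(x) - y)`, then
`δ^H(Ā, A) ≤ g(x̄) - ȳ` (Hausdorff distance w.r.t. the Euclidean norm). -/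
theorem hausdorffDist_le_max_vertex_gap {n : ℕ}
    (g gbar : EuclideanSpace ℝ (Fin n) → ℝ) (hg : ConvexOn ℝ Set.univ g)
    (ℓ u : EuclideanSpace ℝ (Fin n)) (hlu : ∀ i, ℓ i < u i)
    (X : Set (EuclideanSpace ℝ (Fin n)))
    (hX : X = {x | ∀ i, ℓ i ≤ x i ∧ x i ≤ u i})
    (m : ℕ) (c : Fin (m + 1) → EuclideanSpace ℝ (Fin n)) (d : Fin (m + 1) → ℝ)
    (hgbar : ∀ x, gbar x = ⨆ i, (⟪c i, x⟫ + d i))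
    (hunder : ∀ x ∈ X, gbar x ≤ g x)
    (b : ℝ) (hb : ∀ x ∈ X, g x ≤ b)
    (A Abar : Set (EucProd n))
    (hA : A = {p | g (toProd p).1 ≤ (toProd p).2 ∧ (toProd p).1 ∈ X ∧ (toProd p).2 ≤ b})
    (hAbar : Abar =
      {p | gbar (toProd p).1 ≤ (toProd p).2 ∧ (toProd p).1 ∈ X ∧ (toProd p).2 ≤ b})
    (xb : EuclideanSpace ℝ (Fin n)) (yb : ℝ)
    (hmem : ofProd (xb, yb) ∈ Abar.extremePoints ℝ)
    (hmax : ∀ p ∈ Abar.extremePoints ℝ, g (toProd p).1 - (toProd p).2 ≤ g xb - yb) :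
    Metric.hausdorffDist Abar A ≤ g xb - yb := by
  have hXc : IsCompact X := by
    have : X = (EuclideanSpace.equiv (Fin n) ℝ).toHomeomorph ⁻¹' Icc ℓ.ofLp u.ofLp := by
      ext x
      simp [hX, Pi.le_def, forall_and]
    rw [this]
    exact (EuclideanSpace.equiv (Fin n) ℝ).toHomeomorph.isCompact_preimage.2 isCompact_Icc
  have hXconv : Convex ℝ X := by
    subst hX
    intro x hx y hy α β hα hβ hαβ i
    exact convex_Icc (ℓ i) (u i) (hx i) (hy i) hα hβ hαβ
  have hgbar_le (x : EuclideanSpace ℝ (Fin n)) (t : ℝ) :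
      gbar x ≤ t ↔ ∀ i, ⟪c i, x⟫ + d i ≤ t := by
    rw [hgbar, ciSup_le_iff (finite_range _).bddAbove]
  have hAbar' : Abar =
      {p : EucProd n | (∀ i, ⟪c i, p.fst⟫ + d i ≤ p.snd) ∧ p.fst ∈ X ∧ p.snd ≤ b} := by
    rw [hAbar]
    ext p
    exact and_congr_left' (hgbar_le _ _)
  have hcont : Continuous g := continuousOn_univ.1 (hg.continuousOn isOpen_univ)
  have hconv : ConvexOn ℝ univ fun p : EucProd n => g p.fst - p.snd :=
    (hg.comp_linearMap (WithLp.fstL 2 ℝ (EuclideanSpace ℝ (Fin n)) ℝ).toLinearMap).sub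
      ((WithLp.sndL 2 ℝ (EuclideanSpace ℝ (Fin n)) ℝ).toLinearMap.concaveOn convex_univ)
  have hgap : ∀ p ∈ Abar, g p.fst - p.snd ≤ g xb - yb :=
    hconv.le_of_forall_extremePoints_le (by fun_prop)
      (hAbar' ▸ isCompact_truncated_epi hXc c d b)
      (hAbar' ▸ convex_truncated_epi hXconv c d b) hmax
  have hℓ : ℓ ∈ X := by
    rw [hX]
    exact fun i => ⟨le_rfl, (hlu i).le⟩
  have hnonneg : 0 ≤ g xb - yb := by
    have h : g ℓ - gbar ℓ ≤ g xb - yb := hgap (ofProd (ℓ, gbar ℓ)) <| by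
      rw [hAbar]
      exact ⟨le_rfl, hℓ, (hunder ℓ hℓ).trans (hb ℓ hℓ)⟩
    linarith [hunder ℓ hℓ]
  refine Metric.hausdorffDist_le_of_mem_dist hnonneg (fun p hp => ?_) fun p hp => ?_
  · have hp' := hp
    rw [hAbar] at hp'
    obtain ⟨-, hpX, hpb⟩ := hp'
    refine ⟨ofProd (p.fst, max (g p.fst) p.snd), ?_, ?_⟩
    · rw [hA]
      exact ⟨le_max_left _ _, hpX, max_le (hb _ hpX) hpb⟩
    · have hdist : dist p (ofProd (p.fst, max (g p.fst) p.snd)) =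
          |p.snd - max (g p.fst) p.snd| := by
        simp [ofProd, WithLp.prod_dist_eq_of_L2, Real.dist_eq, Real.sqrt_sq_eq_abs]
      rw [hdist, abs_sub_comm, abs_of_nonneg (sub_nonneg.2 (le_max_right _ _)), sub_le_iff_le_add]
      exact max_le (sub_le_iff_le_add.1 (hgap p hp)) (le_add_of_nonneg_left hnonneg)
  · refine ⟨p, ?_, by simpa using hnonneg⟩
    rw [hA] at hp
    rw [hAbar]
    exact ⟨(hunder _ hp.2.1).trans hp.1, hp.2⟩
end

section
/- Let g : ℝⁿ → ℝ be convex, let X = [ℓ,u] ⊆ ℝⁿ be a compact box with nonempty interior, let ḡ : ℝⁿ → ℝ be the pointwise maximum of finitely many affine functions with ḡ ≤ g on X, let b ≥ sup_{x∈X} g(x), and set S := {(x,t) : t ≤ b}, A := epi g ∩ (X × ℝ) ∩ S and Ā := epi ḡ ∩ (X × ℝ) ∩ S. Let (x̄, ȳ) attain max_{(x,y) ∈ ver Ā}(g(x) − y), let c ∈ ∂g(x̄) be a subgradient of g at x̄, and set Ā' := Ā ∩ H(g,x̄), where H(g,x̄) := {(x,t) : t − cᵀx ≥ g(x̄) − cᵀx̄}.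 Then δ^H(Ā, Ā') ≥ δ^H(Ā, A) / ‖(−c,1)‖, where ‖·‖ is the Euclidean norm on ℝ^{n+1} and δ^H is the Hausdorff distance with respect to this norm. -/
open Set
open scoped RealInnerProductSpace

lemma continuous_toProd {n : ℕ} : Continuous (toProd (n := n)) :=
  WithLp.prod_continuous_ofLp 2 _ _

lemma continuous_ofProd {n : ℕ} : Continuous (ofProd (n := n)) :=
  WithLp.prod_continuous_toLp 2 _ _

lemma isCompact_setOf_coordinates_mem_Icc {n : ℕ} (ℓ u : EuclideanSpace ℝ (Fin n)) :
    IsCompact {x : EuclideanSpace ℝ (Fin n) | ∀ i, ℓ i ≤ x i ∧ x i ≤ u i} := by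
  have h : IsCompact (Set.Icc (WithLp.ofLp ℓ) (WithLp.ofLp u)) := isCompact_Icc
  convert h.image (PiLp.continuous_toLp 2 (fun _ : Fin n => ℝ)) using 1
  ext x
  constructor
  · intro hx
    exact ⟨WithLp.ofLp x, ⟨fun i => (hx i).1, fun i => (hx i).2⟩, rfl⟩
  · rintro ⟨y, hy, rfl⟩ i
    exact ⟨hy.1 i, hy.2 i⟩

/-- A continuous convex function is bounded on a compact convex set by any bound valid at the
extreme points. -/
lemma ConvexOn.le_of_extremePoints_le {E : Type*} [NormedAddCommGroup E] [NormedSpace ℝ E]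
    {f : E → ℝ} (hf : ConvexOn ℝ Set.univ f) (hfc : Continuous f) {K : Set E}
    (hK : IsCompact K) (hKc : Convex ℝ K) {M : ℝ} (hM : ∀ p ∈ K.extremePoints ℝ, f p ≤ M)
    {p : E} (hp : p ∈ K) : f p ≤ M := by
  have hconv : Convex ℝ {q | f q ≤ M} := by simpa using hf.convex_le M
  rw [← closure_convexHull_extremePoints hK hKc] at hp
  exact closure_minimal (convexHull_min hM hconv) (isClosed_le hfc continuous_const) hp

lemma ConvexOn.sub_snd_toProd {n : ℕ} {g : EuclideanSpace ℝ (Fin n) → ℝ}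
    (hg : ConvexOn ℝ Set.univ g) :
    ConvexOn ℝ Set.univ fun p : EucProd n => g (toProd p).1 - (toProd p).2 := by
  refine ⟨convex_univ, fun q _ r _ s t hs ht hst => ?_⟩
  have h := hg.2 (mem_univ (toProd q).1) (mem_univ (toProd r).1) hs ht hst
  simp only [smul_eq_mul] at h ⊢
  change g (s • (toProd q).1 + t • (toProd r).1) - (s * (toProd q).2 + t * (toProd r).2) ≤ _
  linarith

lemma dist_ofProd_same_fst {n : ℕ} (x : EuclideanSpace ℝ (Fin n)) (s t : ℝ) :
    dist (ofProd (x, s)) (ofProd (x, t)) = |s - t| := by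
  rw [WithLp.prod_dist_eq_of_L2]
  simp [ofProd, Real.dist_eq, Real.sqrt_sq_eq_abs]

lemma inner_ofProd_neg_one {n : ℕ} (c : EuclideanSpace ℝ (Fin n)) (q : EucProd n) :
    ⟪ofProd (-c, (1 : ℝ)), q⟫ = (toProd q).2 - ⟪c, (toProd q).1⟫ := by
  rw [WithLp.prod_inner_apply]
  simp [ofProd, toProd]
  ring

/-- In the setting of the cutting-plane step, where `(x̄,ȳ)` attains
`max_{(x,y) ∈ ver Ā}(g(x) - y)`, `c ∈ ∂g(x̄)`, and `Ā' := Ā ∩ H(g,x̄)` with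
`H(g,x̄) = {(x,t) : t - cᵀx ≥ g(x̄) - cᵀx̄}`, one has
`δ^H(Ā, Ā') ≥ δ^H(Ā, A) / ‖(-c,1)‖` (Euclidean norm on `ℝ^{n+1}`). -/
theorem hausdorffDist_cut_ge {n : ℕ}
    (g gbar : EuclideanSpace ℝ (Fin n) → ℝ) (hg : ConvexOn ℝ Set.univ g)
    (ℓ u : EuclideanSpace ℝ (Fin n)) (hlu : ∀ i, ℓ i < u i)
    (X : Set (EuclideanSpace ℝ (Fin n)))
    (hX : X = {x | ∀ i, ℓ i ≤ x i ∧ x i ≤ u i})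
    (m : ℕ) (cf : Fin (m + 1) → EuclideanSpace ℝ (Fin n)) (d : Fin (m + 1) → ℝ)
    (hgbar : ∀ x, gbar x = ⨆ i, (⟪cf i, x⟫ + d i))
    (hunder : ∀ x ∈ X, gbar x ≤ g x)
    (b : ℝ) (hb : ∀ x ∈ X, g x ≤ b)
    (A Abar : Set (EucProd n))
    (hA : A = {p | g (toProd p).1 ≤ (toProd p).2 ∧ (toProd p).1 ∈ X ∧ (toProd p).2 ≤ b})
    (hAbar : Abar =
      {p | gbar (toProd p).1 ≤ (toProd p).2 ∧ (toProd p).1 ∈ X ∧ (toProd p).2 ≤ b})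
    (xb : EuclideanSpace ℝ (Fin n)) (yb : ℝ)
    (hmem : ofProd (xb, yb) ∈ Abar.extremePoints ℝ)
    (hmax : ∀ p ∈ Abar.extremePoints ℝ, g (toProd p).1 - (toProd p).2 ≤ g xb - yb)
    (c : EuclideanSpace ℝ (Fin n)) (hc : ∀ z, g xb + ⟪c, z - xb⟫ ≤ g z)
    (Abar' : Set (EucProd n))
    (hAbar' : Abar' = Abar ∩
      {p | g xb - ⟪c, xb⟫ ≤ (toProd p).2 - ⟪c, (toProd p).1⟫}) :
    Metric.hausdorffDist Abar Abar' ≥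
      Metric.hausdorffDist Abar A / ‖ofProd (-c, (1 : ℝ))‖ := by
  have hmemAbar : ∀ p : EucProd n, p ∈ Abar ↔
      (∀ i, ⟪cf i, (toProd p).1⟫ + d i ≤ (toProd p).2) ∧
        (toProd p).1 ∈ X ∧ (toProd p).2 ≤ b := by
    intro p
    rw [hAbar, mem_ofPred_eq, hgbar, ciSup_le_iff (Set.finite_range _).bddAbove]
  have hXc : IsCompact X := hX ▸ isCompact_setOf_coordinates_mem_Icc ℓ u
  have hXconv : Convex ℝ X := by
    rw [hX]
    intro x hx y hy s t hs ht hst i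
    exact convex_Icc (ℓ i) (u i) (hx i) (hy i) hs ht hst
  have hfst : Continuous fun p : EucProd n => (toProd p).1 :=
    continuous_fst.comp continuous_toProd
  have hsnd : Continuous fun p : EucProd n => (toProd p).2 :=
    continuous_snd.comp continuous_toProd
  have hclosed : IsClosed Abar := by
    have h : Abar = {p : EucProd n | ∀ i, ⟪cf i, (toProd p).1⟫ + d i ≤ (toProd p).2} ∩
        ((fun p : EucProd n => (toProd p).1) ⁻¹' X ∩ {p | (toProd p).2 ≤ b}) := by
      ext p
      exact hmemAbar p
    rw [h]
    refine IsClosed.inter ?_ ((hXc.isClosed.preimage hfst).inter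
      (isClosed_le hsnd continuous_const))
    simp only [ofPred_forall]
    exact isClosed_iInter fun i =>
      isClosed_le ((continuous_const.inner hfst).add continuous_const) hsnd
  have hcompact : IsCompact Abar := by
    obtain ⟨L, hL⟩ := hXc.bddBelow_image
      (f := fun x => ⟪cf 0, x⟫ + d 0) (by fun_prop)
    refine ((hXc.prod (isCompact_Icc (a := L) (b := b))).image
      continuous_ofProd).of_isClosed_subset hclosed ?_
    intro p hp
    obtain ⟨h1, h2, h3⟩ := (hmemAbar p).1 hp
    exact ⟨toProd p, ⟨h2, (hL (mem_image_of_mem _ h2)).trans (h1 0), h3⟩, rfl⟩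
  have hconv : Convex ℝ Abar := by
    intro p hp q hq s t hs ht hst
    obtain ⟨h1, h2, h3⟩ := (hmemAbar p).1 hp
    obtain ⟨k1, k2, k3⟩ := (hmemAbar q).1 hq
    refine (hmemAbar _).2 ⟨fun i => ?_, hXconv h2 k2 hs ht hst,
      convex_Iic b h3 k3 hs ht hst⟩
    change ⟪cf i, s • (toProd p).1 + t • (toProd q).1⟫ + d i ≤
      s * (toProd p).2 + t * (toProd q).2
    rw [inner_add_right, real_inner_smul_right, real_inner_smul_right]
    have e1 := mul_le_mul_of_nonneg_left (h1 i) hs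
    have e2 := mul_le_mul_of_nonneg_left (k1 i) ht
    have e3 : s * d i + t * d i = d i := by rw [← add_mul, hst, one_mul]
    linarith
  have hbound : ∀ p ∈ Abar, g (toProd p).1 - (toProd p).2 ≤ g xb - yb := fun p hp =>
    hg.sub_snd_toProd.le_of_extremePoints_le
      (((continuousOn_univ.1 (hg.continuousOn isOpen_univ)).comp hfst).sub hsnd)
      hcompact hconv hmax hp
  have hAsub : A ⊆ Abar := by
    rw [hA, hAbar]
    rintro p ⟨h1, h2, h3⟩
    exact ⟨(hunder _ h2).trans h1, h2, h3⟩
  have hupper : Metric.hausdorffDist Abar A ≤ max (g xb - yb) 0 := by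
    refine Metric.hausdorffDist_le_of_mem_dist (le_max_right _ _) ?_ ?_
    · intro p hp
      have hpg := hbound p hp
      obtain ⟨-, h2, h3⟩ := (hmemAbar p).1 hp
      refine ⟨ofProd ((toProd p).1, max (g (toProd p).1) (toProd p).2), ?_, ?_⟩
      · rw [hA]
        exact ⟨le_max_left _ _, h2, max_le (hb _ h2) h3⟩
      · change dist (ofProd ((toProd p).1, (toProd p).2)) _ ≤ _
        rw [dist_ofProd_same_fst, abs_sub_comm, ← max_sub_sub_right, sub_self,
          abs_of_nonneg (le_max_right _ _)]
        exact max_le_max_right 0 hpg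
    · intro p hp
      exact ⟨p, hAsub hp, (dist_self p).le.trans (le_max_right _ _)⟩
  have hxb : ofProd (xb, yb) ∈ Abar := hmem.1
  obtain ⟨hxb1, hxb2, hxb3⟩ := (hmemAbar _).1 hxb
  have hne : Abar'.Nonempty := by
    refine ⟨ofProd (xb, b), ?_⟩
    rw [hAbar']
    exact ⟨(hmemAbar _).2 ⟨fun i => (hxb1 i).trans hxb3, hxb2, le_rfl⟩,
      sub_le_sub_right (hb xb hxb2) _⟩
  have hsub' : Abar' ⊆ Abar := hAbar' ▸ inter_subset_left
  have hfin := Metric.hausdorffEDist_ne_top_of_nonempty_of_bounded ⟨_, hxb⟩ hne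
    hcompact.isBounded (hcompact.isBounded.subset hsub')
  have hnorm : 0 < ‖ofProd (-c, (1 : ℝ))‖ := by
    rw [norm_pos_iff]
    intro h
    have h2 : (toProd (ofProd (-c, (1 : ℝ)))).2 = (toProd (0 : EucProd n)).2 := by rw [h]
    exact one_ne_zero h2
  have hlower : (g xb - yb) / ‖ofProd (-c, (1 : ℝ))‖ ≤ Metric.hausdorffDist Abar Abar' := by
    refine le_trans ?_ (Metric.infDist_le_hausdorffDist_of_mem hxb hfin)
    refine (Metric.le_infDist hne).2 fun q hq => ?_
    rw [hAbar'] at hq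
    have hcut : g xb - ⟪c, xb⟫ ≤ (toProd q).2 - ⟪c, (toProd q).1⟫ := hq.2
    rw [div_le_iff₀ hnorm, dist_comm, dist_eq_norm, mul_comm]
    refine le_trans ?_ (real_inner_le_norm (ofProd (-c, (1 : ℝ))) (q - ofProd (xb, yb)))
    rw [inner_sub_right, inner_ofProd_neg_one, inner_ofProd_neg_one]
    change g xb - yb ≤ _ - (yb - ⟪c, xb⟫)
    linarith
  refine (div_le_div_of_nonneg_right hupper hnorm.le).trans ?_
  rcases le_total (g xb - yb) 0 with h | h
  · rw [max_eq_right h, zero_div]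
    exact Metric.hausdorffDist_nonneg
  · rwa [max_eq_left h]
end

section
/- Let A ⊆ ℝ^m be a nonempty compact set and let (A_k)_{k≥0} be a nonincreasing sequence of nonempty compact sets with A ⊆ A_{k+1} ⊆ A_k for all k. If there exists γ > 0 such that δ^H(A_k, A_{k+1}) ≥ γ · δ^H(A_k, A) for all k ≥ 0, then lim_{k→∞} δ^H(A_k, A) = 0. -/
open Set Filter

/-- Consecutive Hausdorff distances of a decreasing sequence of compact sets tend to zero. -/
theorem tendsto_hausdorffDist_succ_of_antitone_isCompact {X : Type*} [MetricSpace X]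
    {K : ℕ → Set X} (hK : Antitone K) (hcomp : ∀ k, IsCompact (K k)) :
    Tendsto (fun k => Metric.hausdorffDist (K k) (K (k + 1))) atTop (nhds 0) := by
  refine Metric.tendsto_atTop.2 fun ε hε => ?_
  obtain ⟨N, hN⟩ : ∃ N, K N ⊆ Metric.thickening (ε / 2) (⋂ k, K k) :=
    exists_subset_nhds_of_isCompact hK.directed_ge hcomp fun x hx =>
      Metric.isOpen_thickening.mem_nhds (Metric.self_subset_thickening (half_pos hε) _ hx)
  refine ⟨N, fun k hk => ?_⟩
  have hle : Metric.hausdorffDist (K k) (K (k + 1)) ≤ ε / 2 := by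
    refine Metric.hausdorffDist_le_of_mem_dist (half_pos hε).le (fun x hx => ?_) fun x hx =>
      ⟨x, hK k.le_succ hx, by simpa using (half_pos hε).le⟩
    obtain ⟨y, hy, hxy⟩ := Metric.mem_thickening_iff.1 (hN (hK hk hx))
    exact ⟨y, mem_iInter.1 hy (k + 1), hxy.le⟩
  rw [Real.dist_0_eq_abs, abs_of_nonneg Metric.hausdorffDist_nonneg]
  linarith

/-- If `A ⊆ ℝ^m` is a nonempty compact set, `(A_k)` is a nonincreasing
sequence of nonempty compact sets with `A ⊆ A_{k+1} ⊆ A_k`, and there is `γ > 0`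
with `δ^H(A_k, A_{k+1}) ≥ γ · δ^H(A_k, A)` for all `k`, then
`δ^H(A_k, A) → 0` as `k → ∞`. -/
theorem hausdorffDist_tendsto_zero_of_cutting {m : ℕ}
    (A : Set (EuclideanSpace ℝ (Fin m)))
    (hAne : A.Nonempty) (hAcomp : IsCompact A)
    (Ak : ℕ → Set (EuclideanSpace ℝ (Fin m)))
    (hAkne : ∀ k, (Ak k).Nonempty) (hAkcomp : ∀ k, IsCompact (Ak k))
    (hsub : ∀ k, A ⊆ Ak (k + 1)) (hmono : ∀ k, Ak (k + 1) ⊆ Ak k)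
    (γ : ℝ) (hγ : 0 < γ)
    (hcut : ∀ k, Metric.hausdorffDist (Ak k) (Ak (k + 1)) ≥
      γ * Metric.hausdorffDist (Ak k) A) :
    Tendsto (fun k => Metric.hausdorffDist (Ak k) A) atTop (nhds 0) := by
  have hlim := (tendsto_hausdorffDist_succ_of_antitone_isCompact
    (antitone_nat_of_succ_le hmono) hAkcomp).div_const γ
  rw [zero_div] at hlim
  refine squeeze_zero (fun _ => Metric.hausdorffDist_nonneg) (fun k => ?_) hlim
  rw [le_div_iff₀' hγ]
  exact hcut k
end

section
/- Let g : ℝⁿ → ℝ be convex, let ε > 0 and β > 0. Let x̄ ∈ ℝⁿ, let c ∈ ∂g(x̄) be a subgradient of g at x̄ with ‖(−c,1)‖ ≤ β (Euclidean norm on ℝ^{n+1}), and let ȳ ∈ ℝ satisfy g(x̄) − ȳ > ε. Set v̄ := (x̄, ȳ), ā := (x̄, g(x̄)), m := (−c,1)/‖(−c,1)‖, and H^ε := {s ∈ ℝ^{n+1} : mᵀs ≥ mᵀā − ε/(2β)}. Then the closed Euclidean ball B[v̄, ε/(4β)] is disjoint from H^ε. -/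
open Set
open scoped RealInnerProductSpace

/-- With `c ∈ ∂g(x̄)`, `‖(-c,1)‖ ≤ β`, `g(x̄) - ȳ > ε`,
`v̄ = (x̄,ȳ)`, `ā = (x̄,g(x̄))`, `m = (-c,1)/‖(-c,1)‖` and
`H^ε = {s : mᵀs ≥ mᵀā - ε/(2β)}`, the closed ball `B[v̄, ε/(4β)]` is disjoint
from `H^ε`. -/
theorem ball_disjoint_shifted_halfspace {n : ℕ}
    (g : EuclideanSpace ℝ (Fin n) → ℝ) (hg : ConvexOn ℝ Set.univ g)
    (ε β : ℝ) (hε : 0 < ε) (hβ : 0 < β)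
    (xb : EuclideanSpace ℝ (Fin n)) (c : EuclideanSpace ℝ (Fin n))
    (hc : ∀ z, g xb + ⟪c, z - xb⟫ ≤ g z)
    (hcβ : ‖ofProd (-c, (1 : ℝ))‖ ≤ β)
    (yb : ℝ) (hgap : g xb - yb > ε)
    (vb ab mvec : EucProd n) (Hε : Set (EucProd n))
    (hvb : vb = ofProd (xb, yb)) (hab : ab = ofProd (xb, g xb))
    (hm : mvec = ‖ofProd (-c, (1 : ℝ))‖⁻¹ • ofProd (-c, (1 : ℝ)))
    (hHε : Hε = {s | ⟪mvec, ab⟫ - ε / (2 * β) ≤ ⟪mvec, s⟫}) :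
    Disjoint (Metric.closedBall vb (ε / (4 * β))) Hε := by
  rw [Set.disjoint_left]
  intro s hs hsH
  rw [hHε, Set.mem_ofPred_eq] at hsH
  rw [Metric.mem_closedBall, dist_eq_norm] at hs
  set w : EucProd n := ofProd (-c, (1 : ℝ)) with hw
  have hwne : w ≠ 0 := fun h => one_ne_zero (α := ℝ) (congrArg (fun p => p.snd) h)
  have hwpos : 0 < ‖w‖ := norm_pos_iff.mpr hwne
  have hnorm : ‖mvec‖ = 1 := by
    rw [hm, norm_smul, norm_inv, norm_norm, inv_mul_cancel₀ hwpos.ne']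
  have hsv : ⟪mvec, s - vb⟫ ≤ ε / (4 * β) := by
    have h := real_inner_le_norm mvec (s - vb)
    rw [hnorm, one_mul] at h
    exact h.trans hs
  have hav : ⟪mvec, ab - vb⟫ = (g xb - yb) / ‖w‖ := by
    have h : ⟪w, ab - vb⟫ = g xb - yb := by
      simp [hw, hab, hvb, ofProd, WithLp.prod_inner_apply]
    rw [hm, real_inner_smul_left, h, div_eq_inv_mul]
  have hlt : ε / β < (g xb - yb) / ‖w‖ :=
    div_lt_div₀ hgap hcβ (hε.trans hgap).le hwpos
  rw [inner_sub_right] at hsv hav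
  have h2 : ε / (2 * β) = ε / β / 2 := by field_simp
  have h4 : ε / (4 * β) = ε / β / 4 := by field_simp
  have hpos : 0 < ε / β := div_pos hε hβ
  linarith
end

section
/- Let ε > 0, let X ⊆ ℝⁿ be a nonempty convex compact set, let g, h : ℝⁿ → ℝ be convex functions, and let ḡ : ℝⁿ → ℝ be a polyhedral convex function with ḡ(x) ≤ g(x) for all x ∈ X. Let x̄ ∈ X be a minimizer of ḡ − h over X, let z* := min_{x∈X}(g(x) − h(x)) and z̄ := min_{x∈X}(ḡ(x) − h(x)). If g(x̄) − ḡ(x̄) ≤ ε, then x̄ is an ε-solution of min_{x∈X}(g(x) − h(x)), and 0 ≤ z* − z̄ ≤ ε. -/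
open Set

/-- If `ḡ` is a polyhedral underestimator of `g` on `X`, `x̄` minimizes
`ḡ - h` over `X`, and `g(x̄) - ḡ(x̄) ≤ ε`, then `x̄` is an `ε`-solution of
`min_{x∈X}(g(x) - h(x))` and `0 ≤ z* - z̄ ≤ ε`. -/
theorem eps_solution_of_local_gap {n : ℕ}
    (ε : ℝ) (hε : 0 < ε)
    (X : Set (EuclideanSpace ℝ (Fin n)))
    (hXne : X.Nonempty) (hXconv : Convex ℝ X) (hXcomp : IsCompact X)
    (g h gbar : EuclideanSpace ℝ (Fin n) → ℝ)
    (hg : ConvexOn ℝ Set.univ g) (hh : ConvexOn ℝ Set.univ h)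
    (hpoly : IsPolyhedralFun gbar)
    (hunder : ∀ x ∈ X, gbar x ≤ g x)
    (xb : EuclideanSpace ℝ (Fin n)) (hxb : xb ∈ X)
    (hxbmin : ∀ x ∈ X, gbar xb - h xb ≤ gbar x - h x)
    (zstar zbar : ℝ)
    (hzstar : IsLeast ((fun x => g x - h x) '' X) zstar)
    (hzbar : IsLeast ((fun x => gbar x - h x) '' X) zbar)
    (hgap : g xb - gbar xb ≤ ε) :
    g xb - h xb ≤ zstar + ε ∧ 0 ≤ zstar - zbar ∧ zstar - zbar ≤ ε := by
  obtain ⟨⟨xs, hxs, rfl⟩, hstar⟩ := hzstar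
  obtain ⟨⟨y, hy, rfl⟩, hbar⟩ := hzbar
  have hstar_xb := hstar ⟨xb, hxb, rfl⟩
  have hbar_xs := hbar ⟨xs, hxs, rfl⟩
  have hmin_xs := hxbmin xs hxs
  have hmin_y := hxbmin y hy
  have hunder_xs := hunder xs hxs
  dsimp only at *
  exact ⟨by linarith, by linarith, by linarith⟩
end

section
/- Let X ⊆ ℝⁿ be a nonempty convex compact set, let g, h : ℝⁿ → ℝ be convex functions, let g^{k−1} : ℝⁿ → ℝ satisfy g^{k−1}(x) ≤ g(x) for all x ∈ X, let x^k ∈ X be a minimizer of g^{k−1} − h over X, let c^k ∈ ∂g(x^k), and set g^k(x) := max{g^{k−1}(x), g(x^k) + (c^k)ᵀ(x − x^k)}. Then, with a_k := g^{k−1}(x^k) − h(x^k) and b_k := g^k(x^k) − h(x^k), it holds that a_k ≤ min_{x∈X}(g(x) − h(x)) ≤ b_k. -/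
open Set
open scoped RealInnerProductSpace

/-- If `g^{k-1} ≤ g` on `X`, `x^k` minimizes `g^{k-1} - h` over `X`,
`c^k ∈ ∂g(x^k)` and `g^k := max{g^{k-1}, s^k}` with `s^k` the supporting affine
function of `g` at `x^k`, then, with `a_k := g^{k-1}(x^k) - h(x^k)` and
`b_k := g^k(x^k) - h(x^k)`, one has `a_k ≤ min_{x∈X}(g(x)-h(x)) ≤ b_k`. -/
theorem sandwich_bounds_of_cut_iteration {n : ℕ}
    (X : Set (EuclideanSpace ℝ (Fin n)))
    (hXne : X.Nonempty) (hXconv : Convex ℝ X) (hXcomp : IsCompact X)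
    (g h : EuclideanSpace ℝ (Fin n) → ℝ)
    (hg : ConvexOn ℝ Set.univ g) (hh : ConvexOn ℝ Set.univ h)
    (gkm1 : EuclideanSpace ℝ (Fin n) → ℝ)
    (hgkm1 : ∀ x ∈ X, gkm1 x ≤ g x)
    (xk : EuclideanSpace ℝ (Fin n)) (hxk : xk ∈ X)
    (hxkmin : ∀ x ∈ X, gkm1 xk - h xk ≤ gkm1 x - h x)
    (ck : EuclideanSpace ℝ (Fin n))
    (hck : ∀ x, g xk + ⟪ck, x - xk⟫ ≤ g x)
    (gk : EuclideanSpace ℝ (Fin n) → ℝ)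
    (hgk : ∀ x, gk x = max (gkm1 x) (g xk + ⟪ck, x - xk⟫))
    (ak bk zstar : ℝ)
    (hak : ak = gkm1 xk - h xk) (hbk : bk = gk xk - h xk)
    (hzstar : IsLeast ((fun x => g x - h x) '' X) zstar) :
    ak ≤ zstar ∧ zstar ≤ bk := by
  obtain ⟨⟨x, hx, rfl⟩, hlb⟩ := hzstar
  have hgle : g xk ≤ gk xk := by simp [hgk]
  have hmin := hxkmin x hx
  have hunder := hgkm1 x hx
  have hval : g x - h x ≤ g xk - h xk := hlb ⟨xk, hxk, rfl⟩
  constructor <;> dsimp only <;> linarith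
end

section
/- Let X ⊆ ℝⁿ be a nonempty convex compact set and g, h : ℝⁿ → ℝ be convex functions. Let x^0 ∈ X, c^0 ∈ ∂g(x^0), and g^0(x) := g(x^0) + (c^0)ᵀ(x − x^0). For each k ≥ 1, let x^k ∈ X be a minimizer of g^{k−1} − h over X, let c^k ∈ ∂g(x^k), set s^k(x) := g(x^k) + (c^k)ᵀ(x − x^k), and g^k(x) := max{g^{k−1}(x), s^k(x)}. Then every limit point of the sequence (x^k)_{k≥0} is a global minimizer of g − h over X; in particular, along any convergent subsequence (x^{k_j}), g(x^{k_j}) − h(x^{k_j}) converges to min_{x∈X}(g(x) − h(x)). -/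
open Set Filter
open scoped RealInnerProductSpace

/-- Subgradients of a continuous function at points of a compact set are uniformly bounded. -/
theorem exists_norm_subgradient_le {E : Type*} [NormedAddCommGroup E] [InnerProductSpace ℝ E]
    [ProperSpace E] {X : Set E} (hX : IsCompact X) {g : E → ℝ} (hg : Continuous g) :
    ∃ C : ℝ, ∀ x ∈ X, ∀ c : E, (∀ z, g x + ⟪c, z - x⟫ ≤ g z) → ‖c‖ ≤ C := by
  obtain ⟨M, hM⟩ := (hX.cthickening (r := 1)).exists_bound_of_continuousOn hg.continuousOn
  refine ⟨max 0 (M + M), fun x hx c hc => ?_⟩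
  rcases eq_or_ne c 0 with rfl | hc0
  · simp
  have hpos : 0 < ‖c‖ := norm_pos_iff.mpr hc0
  have hz : x + ‖c‖⁻¹ • c ∈ Metric.cthickening 1 X := by
    refine Metric.mem_cthickening_of_dist_le _ x 1 X hx ?_
    simp [norm_smul, hpos.ne']
  have hsub := hc (x + ‖c‖⁻¹ • c)
  have hinner : ⟪c, x + ‖c‖⁻¹ • c - x⟫ = ‖c‖ := by
    rw [add_sub_cancel_left, real_inner_smul_right, real_inner_self_eq_norm_sq]
    field_simp
  rw [hinner] at hsub
  have hMx := abs_le.mp (hM x (Metric.self_subset_cthickening X hx))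
  have hMz := abs_le.mp (hM _ hz)
  exact le_max_of_le_right (by linarith [hMx.1, hMz.2])

/-- For the cutting-plane DC algorithm with `ε = 0` — starting from
`g^0(x) = g(x^0) + (c^0)ᵀ(x - x^0)` and, for `k ≥ 1`, choosing `x^k` a minimizer of
`g^{k-1} - h` over `X`, `c^k ∈ ∂g(x^k)`, `s^k(x) = g(x^k) + (c^k)ᵀ(x - x^k)`, and
`g^k = max{g^{k-1}, s^k}` — every limit point of `(x^k)` is a global minimizer of
`g - h` over `X`, and along any convergent subsequence `(x^{k_j})` the values
`g(x^{k_j}) - h(x^{k_j})` converge to `min_{x∈X}(g(x) - h(x))`. -/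
theorem limit_points_are_global_minimizers {n : ℕ}
    (X : Set (EuclideanSpace ℝ (Fin n)))
    (hXne : X.Nonempty) (hXconv : Convex ℝ X) (hXcomp : IsCompact X)
    (g h : EuclideanSpace ℝ (Fin n) → ℝ)
    (hg : ConvexOn ℝ Set.univ g) (hh : ConvexOn ℝ Set.univ h)
    (x c : ℕ → EuclideanSpace ℝ (Fin n))
    (G : ℕ → EuclideanSpace ℝ (Fin n) → ℝ)
    (hx0 : x 0 ∈ X)
    (hc : ∀ k, ∀ z, g (x k) + ⟪c k, z - x k⟫ ≤ g z)
    (hG0 : ∀ z, G 0 z = g (x 0) + ⟪c 0, z - x 0⟫)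
    (hGk : ∀ k, ∀ z, G (k + 1) z = max (G k z) (g (x (k + 1)) + ⟪c (k + 1), z - x (k + 1)⟫))
    (hxk : ∀ k, x (k + 1) ∈ X)
    (hxkmin : ∀ k, ∀ z ∈ X, G k (x (k + 1)) - h (x (k + 1)) ≤ G k z - h z)
    (zstar : ℝ) (hzstar : IsLeast ((fun z => g z - h z) '' X) zstar) :
    (∀ p : EuclideanSpace ℝ (Fin n), MapClusterPt p atTop x →
        p ∈ X ∧ ∀ z ∈ X, g p - h p ≤ g z - h z) ∧
      (∀ φ : ℕ → ℕ, StrictMono φ → ∀ p : EuclideanSpace ℝ (Fin n),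
        Tendsto (fun j => x (φ j)) atTop (nhds p) →
        Tendsto (fun j => g (x (φ j)) - h (x (φ j))) atTop (nhds zstar)) := by
  have hgc : Continuous g := continuousOn_univ.mp (hg.continuousOn isOpen_univ)
  have hhc : Continuous h := continuousOn_univ.mp (hh.continuousOn isOpen_univ)
  have hxX : ∀ k, x k ∈ X := fun k => by
    cases k with
    | zero => exact hx0
    | succ k => exact hxk k
  obtain ⟨C, hC⟩ := exists_norm_subgradient_le hXcomp hgc
  have hcC : ∀ k, ‖c k‖ ≤ C := fun k => hC _ (hxX k) _ (hc k)
  have hGle : ∀ k z, G k z ≤ g z := fun k z => by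
    induction k with
    | zero => exact (hG0 z).trans_le (hc 0 z)
    | succ k ih => exact (hGk k z).trans_le (max_le ih (hc (k + 1) z))
  have hGmono : ∀ z, Monotone fun k => G k z := fun z =>
    monotone_nat_of_le_succ fun k => (le_max_left _ _).trans_eq (hGk k z).symm
  have hcut : ∀ i z, g (x i) + ⟪c i, z - x i⟫ ≤ G i z := fun i z => by
    cases i with
    | zero => exact (hG0 z).ge
    | succ i => exact (le_max_right _ _).trans_eq (hGk i z).symm
  obtain ⟨⟨w, hwX, hw⟩, hlb⟩ := hzstar
  have hle : ∀ z ∈ X, zstar ≤ g z - h z := fun z hz => hlb ⟨z, hz, rfl⟩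
  have hkey : ∀ i m, i < m → g (x i) - C * ‖x m - x i‖ - h (x m) ≤ zstar := fun i m him => by
    obtain ⟨k, rfl⟩ := Nat.exists_eq_succ_of_ne_zero (Nat.ne_zero_of_lt him)
    have hmin := hxkmin k w hwX
    have hcutk := (hcut i (x (k + 1))).trans (hGmono (x (k + 1)) (Nat.lt_succ_iff.mp him))
    have hcs := neg_le_of_abs_le (abs_real_inner_le_norm (c i) (x (k + 1) - x i))
    have hbd := mul_le_mul_of_nonneg_right (hcC i) (norm_nonneg (x (k + 1) - x i))
    have hGw := hGle k w
    simp only [Nat.succ_eq_add_one] at hcutk hw ⊢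
    linarith
  have hlim : ∀ φ : ℕ → ℕ, StrictMono φ → ∀ p, Tendsto (fun j => x (φ j)) atTop (nhds p) →
      p ∈ X ∧ g p - h p = zstar := fun φ hφ p hp => by
    have hpX : p ∈ X := hXcomp.isClosed.mem_of_tendsto hp (Eventually.of_forall fun j => hxX _)
    have hp' := hp.comp (tendsto_add_atTop_nat 1)
    have hgap : Tendsto
        (fun j => g (x (φ j)) - C * ‖x (φ (j + 1)) - x (φ j)‖ - h (x (φ (j + 1))))
        atTop (nhds (g p - C * ‖p - p‖ - h p)) :=
      (((hgc.tendsto p).comp hp).sub ((hp'.sub hp).norm.const_mul C)).sub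
        ((hhc.tendsto p).comp hp')
    have hple := le_of_tendsto' hgap fun j => hkey _ _ (hφ (Nat.lt_succ_self j))
    rw [sub_self, norm_zero, mul_zero, sub_zero] at hple
    exact ⟨hpX, hple.antisymm (hle p hpX)⟩
  refine ⟨fun p hp => ?_, fun φ hφ p hp => ?_⟩
  · obtain ⟨φ, hφ, hφp⟩ := hp.tendsto_subseq
    obtain ⟨hpX, hpz⟩ := hlim φ hφ p hφp
    exact ⟨hpX, fun z hz => hpz.trans_le (hle z hz)⟩
  · rw [← (hlim φ hφ p hp).2]
    exact ((hgc.sub hhc).tendsto p).comp hp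
end

section
/- Let X ⊆ ℝⁿ be a nonempty convex compact set and g, h : ℝⁿ → ℝ be convex functions. Let x^0 ∈ X, c^0 ∈ ∂g(x^0), and g^0(x) := g(x^0) + (c^0)ᵀ(x − x^0). For each k ≥ 1, let x^k ∈ X be a minimizer of g^{k−1} − h over X, let c^k ∈ ∂g(x^k), set s^k(x) := g(x^k) + (c^k)ᵀ(x − x^k), and g^k(x) := max{g^{k−1}(x), s^k(x)}. Then for every ε̃ > 0 there exists k ≥ 1 such that g(x^k) − g^{k−1}(x^k) ≤ ε̃; i.e., the stopping criterion of the cutting-plane DC algorithm with tolerance ε̃ > 0 is met after finitely many iterations. -/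
open Set Filter
open scoped RealInnerProductSpace

/-- Subgradients of a continuous function at points of a compact set are uniformly bounded. -/
lemma exists_norm_le_of_subgradient_of_isCompact {E : Type*} [NormedAddCommGroup E]
    [InnerProductSpace ℝ E] [ProperSpace E] {X : Set E} (hX : IsCompact X) {g : E → ℝ}
    (hg : Continuous g) :
    ∃ L : ℝ, ∀ y ∈ X, ∀ c : E, (∀ z, g y + ⟪c, z - y⟫ ≤ g z) → ‖c‖ ≤ L := by
  obtain ⟨M, hM⟩ := (hX.cthickening (r := 1)).exists_bound_of_continuousOn hg.continuousOn
  refine ⟨2 * M, fun y hy c hc => ?_⟩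
  have hyM := abs_le.1 (hM y (Metric.self_subset_cthickening X hy))
  rcases eq_or_ne c 0 with rfl | hc0
  · rw [norm_zero]
    linarith
  have hcn : ‖c‖ ≠ 0 := norm_ne_zero_iff.2 hc0
  have hmem : y + ‖c‖⁻¹ • c ∈ Metric.cthickening 1 X := by
    refine Metric.mem_cthickening_of_dist_le _ y 1 X hy ?_
    simp [dist_eq_norm, norm_smul, hcn]
  have hzM := abs_le.1 (hM _ hmem)
  have hsub := hc (y + ‖c‖⁻¹ • c)
  have hinner : ⟪c, y + ‖c‖⁻¹ • c - y⟫ = ‖c‖ := by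
    rw [add_sub_cancel_left, real_inner_smul_right, real_inner_self_eq_norm_sq]
    field_simp
  rw [hinner] at hsub
  linarith

/-- A pointwise maximum of successive cuts dominates each earlier cut. -/
lemma le_of_le_succ_max {α : Type*} {G s : ℕ → α → ℝ} (h0 : ∀ z, G 0 z = s 0 z)
    (hsucc : ∀ k z, G (k + 1) z = max (G k z) (s (k + 1) z)) {j k : ℕ} (hjk : j ≤ k) (z : α) :
    s j z ≤ G k z := by
  induction k, hjk using Nat.le_induction with
  | base =>
    cases j with
    | zero => exact (h0 z).ge
    | succ j => exact (le_max_right _ _).trans (hsucc j z).ge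
  | succ k _ ih => exact ih.trans ((le_max_left _ _).trans (hsucc k z).ge)

/-- For the cutting-plane DC algorithm — starting from
`g^0(x) = g(x^0) + (c^0)ᵀ(x - x^0)` and, for `k ≥ 1`, choosing `x^k` a minimizer of
`g^{k-1} - h` over `X`, `c^k ∈ ∂g(x^k)`, `s^k(x) = g(x^k) + (c^k)ᵀ(x - x^k)`, and
`g^k = max{g^{k-1}, s^k}` — for every `ε̃ > 0` there exists `k ≥ 1` with
`g(x^k) - g^{k-1}(x^k) ≤ ε̃`: the stopping criterion with tolerance `ε̃ > 0`
is met after finitely many iterations. -/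
theorem stopping_criterion_met_finitely {n : ℕ}
    (X : Set (EuclideanSpace ℝ (Fin n)))
    (hXne : X.Nonempty) (hXconv : Convex ℝ X) (hXcomp : IsCompact X)
    (g h : EuclideanSpace ℝ (Fin n) → ℝ)
    (hg : ConvexOn ℝ Set.univ g) (hh : ConvexOn ℝ Set.univ h)
    (x c : ℕ → EuclideanSpace ℝ (Fin n))
    (G : ℕ → EuclideanSpace ℝ (Fin n) → ℝ)
    (hx0 : x 0 ∈ X)
    (hc : ∀ k, ∀ z, g (x k) + ⟪c k, z - x k⟫ ≤ g z)
    (hG0 : ∀ z, G 0 z = g (x 0) + ⟪c 0, z - x 0⟫)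
    (hGk : ∀ k, ∀ z, G (k + 1) z = max (G k z) (g (x (k + 1)) + ⟪c (k + 1), z - x (k + 1)⟫))
    (hxk : ∀ k, x (k + 1) ∈ X)
    (hxkmin : ∀ k, ∀ z ∈ X, G k (x (k + 1)) - h (x (k + 1)) ≤ G k z - h z) :
    ∀ εt : ℝ, 0 < εt → ∃ k : ℕ, g (x (k + 1)) - G k (x (k + 1)) ≤ εt := by
  intro εt hεt
  by_contra! hgap
  have hgc : Continuous g := hg.locallyLipschitz.continuous
  have hxX : ∀ k, x k ∈ X := fun k => by
    cases k with
    | zero => exact hx0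
    | succ k => exact hxk k
  obtain ⟨L, hL⟩ := exists_norm_le_of_subgradient_of_isCompact hXcomp hgc
  have hlt : ∀ j k, j < k → εt ≤ g (x k) - g (x j) + L * ‖x k - x j‖ := by
    intro j k hjk
    obtain ⟨k, rfl⟩ := Nat.exists_eq_succ_of_ne_zero (Nat.ne_zero_of_lt hjk)
    have hcut := le_of_le_succ_max (s := fun k z => g (x k) + ⟪c k, z - x k⟫) hG0 hGk
      (Nat.lt_succ_iff.1 hjk) (x (k + 1))
    have habs := (abs_le.1 (abs_real_inner_le_norm (c j) (x (k + 1) - x j))).1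
    have hmul := mul_le_mul_of_nonneg_right (hL _ (hxX j) (c j) (hc j))
      (norm_nonneg (x (k + 1) - x j))
    have hk := hgap k
    simp only [Nat.succ_eq_add_one] at *
    linarith
  obtain ⟨a, -, φ, hφ, hlim⟩ := hXcomp.tendsto_subseq hxX
  have hlim' : Tendsto (fun m => x (φ (m + 1))) atTop (nhds a) :=
    hlim.comp (tendsto_add_atTop_nat 1)
  have hglim := (hgc.tendsto a).comp hlim
  have hglim' := (hgc.tendsto a).comp hlim'
  have htend := (hglim'.sub hglim).add ((hlim'.sub hlim).norm.const_mul L)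
  have hle : εt ≤ g a - g a + L * ‖a - a‖ :=
    ge_of_tendsto' htend fun m => hlt _ _ (hφ m.lt_succ_self)
  simp only [sub_self, norm_zero, mul_zero, add_zero] at hle
  linarith
end
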